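/- For every β∈Δ⁺, s∈ℤ, k∈ℕ, every sign ε∈{+,−}, and every choice of decomposition of s used in defining Ẽ^ε_{β,s}, the normalized divided power Ẽ^{ε,(k)}_{β,s} belongs to the Lusztig integral form 𝐔_v^>(Lo_{2n}). -/

import Mathlib

noncomputable section
open scoped BigOperators DirectSum

/-! ### Base field ℚ(v) and quantum numbers -/

/-- the base field `ℚ(v)`. -/
abbrev KK : Type := RatFunc ℚ
/-- the variable `v ∈ ℚ(v)`. -/
def vv : KK := RatFunc.X
/-- integer powers of `v`. -/
def vpow (m : ℤ) : KK := vv ^ m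
/-- the quantum integer `[m]_u = (uᵐ - u⁻ᵐ)/(u - u⁻¹)`. -/
def qInt (u : KK) (m : ℕ) : KK := (u ^ (m : ℤ) - u ^ (-(m : ℤ))) / (u - u⁻¹)
/-- the quantum factorial `[m]_u!`. -/
def qFact (u : KK) (m : ℕ) : KK := ∏ k ∈ Finset.range m, qInt u (k + 1)
/-- the quantum binomial coefficient. -/
def qBinom (u : KK) (m k : ℕ) : KK := qFact u m / (qFact u k * qFact u (m - k))
/-- `⟨m⟩_v = vᵐ - v⁻ᵐ`. -/
def qBrack (m : ℕ) : KK := vpow (m : ℤ) - vpow (-(m : ℤ))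
/-- the sign `ε ∈ {+,-}` as `±1`. -/
def sgn (ε : Bool) : ℤ := if ε then 1 else -1
/-- `l` is an integer power of `v`. -/
def IsVpow (l : KK) : Prop := ∃ m : ℤ, l = vpow m

/-! ### Cartan data of types `C_n` and `D_n` (1-based indices) -/

/-- the Cartan matrix of type `C_n` (1-based indices). -/
def aC (n i j : ℕ) : ℤ :=
  if i = j then 2 else if i + 1 = n ∧ j = n then -2
  else if i + 1 = j ∨ j + 1 = i then -1 else 0
/-- the symmetrizing integers `d_i` of type `C_n`. -/
def dC (n i : ℕ) : ℕ := if i = n then 2 else 1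
/-- the Cartan matrix of type `D_n` (1-based indices). -/
def aD (n i j : ℕ) : ℤ :=
  if i = j then 2
  else if (i + 1 = j ∧ j + 1 ≤ n) ∨ (j + 1 = i ∧ i + 1 ≤ n) then -1
  else if (i + 2 = n ∧ j = n) ∨ (j + 2 = n ∧ i = n) then -1 else 0
/-- the symmetrizing integers `d_i` of type `D_n` (all equal to `1`). -/
def dD (n i : ℕ) : ℕ := 1

/-! ### The positive subalgebra of the quantum loop algebra, for Cartan data `(A, Dd)` -/

section Ualg
variable (n : ℕ) (A : ℕ → ℕ → ℤ) (Dd : ℕ → ℕ)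

/-- the free `ℚ(v)`-algebra on generators `e_{i,r}`, `i ∈ I`, `r ∈ ℤ`. -/
abbrev FA := FreeAlgebra KK (Fin n × ℤ)
/-- the free generator `e_{i,r}`. -/
def fg (i : Fin n) (r : ℤ) : FA n := FreeAlgebra.ι KK (i, r)

/-- the `z^{-r₁}⋯z^{-r_m}w^{-t}`-coefficient of the Serre relation between colors `i ≠ j`. -/
def serreElt (i j : Fin n) (m : ℕ) (r : Fin m → ℤ) (t : ℤ) : FA n :=
  ∑ σ : Equiv.Perm (Fin m), ∑ k ∈ Finset.range (m + 1),
    ((-1 : KK) ^ k * qBinom (vpow (Dd (i.1 + 1))) m k) •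
      (((List.ofFn fun l => fg n i (r (σ l))).take k
        ++ fg n j t :: (List.ofFn fun l => fg n i (r (σ l))).drop k).prod)

/-- the defining relations of `U_v^>(Lg)` in the new Drinfeld realization: the coefficients of
`(z - v_i^{a_ij} w) e_i(z) e_j(w) = (v_i^{a_ij} z - w) e_j(w) e_i(z)` and of the Serre relations. -/
inductive URel : FA n → FA n → Prop
  | loop (i j : Fin n) (r s : ℤ) :
      URel (fg n i (r + 1) * fg n j s
             - vpow ((Dd (i.1 + 1) : ℤ) * A (i.1 + 1) (j.1 + 1)) • (fg n i r * fg n j (s + 1)))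
           (vpow ((Dd (i.1 + 1) : ℤ) * A (i.1 + 1) (j.1 + 1)) • (fg n j s * fg n i (r + 1))
             - fg n j (s + 1) * fg n i r)
  | serre (i j : Fin n) (hij : i ≠ j) (r : Fin (1 - A (i.1 + 1) (j.1 + 1)).toNat → ℤ) (t : ℤ) :
      URel (serreElt n Dd i j _ r t) 0

/-- the positive subalgebra `U_v^>(Lg)` of the quantum loop algebra. -/
abbrev UA := RingQuot (URel n A Dd)
/-- the generator `e_{i,r}` of `U_v^>(Lg)`. -/
def ug (i : Fin n) (r : ℤ) : UA n A Dd := RingQuot.mkAlgHom KK (URel n A Dd) (fg n i r)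
/-- the generator `e_{i,r}` with a 1-based index `1 ≤ i ≤ n` (and junk value `0` otherwise). -/
def g1 (i : ℕ) (r : ℤ) : UA n A Dd := if h : 1 ≤ i ∧ i ≤ n then ug n A Dd ⟨i - 1, by omega⟩ r else 0

end Ualg

/-! ### `q`-brackets, ordered monomials, and ℤ[v,v⁻¹]-forms -/

section Aux
variable {B : Type} [Ring B] [Module KK B]

/-- the `u`-commutator `[x,y]_u = xy - u · yx`. -/
def qcm (u : KK) (x y : B) : B := x * y - u • (y * x)

/-- the iterated `q`-bracket `[⋯[[g i₁ s₁, g i₂ s₂]_{λ₁}, g i₃ s₃]_{λ₂}, ⋯]_{λ_{ℓ-1}}`. -/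
def chainE (g : ℕ → ℤ → B) (w : List ℕ) (ss : List ℤ) (ls : List KK) : B :=
  match w, ss with
  | i :: w', s :: ss' =>
      ((w'.zip ss').zip ls).foldl
        (fun acc p => acc * g p.1.1 p.1.2 - p.2 • (g p.1.1 p.1.2 * acc)) (g i s)
  | _, _ => 0
end Aux

section Mon
variable {B : Type} [Ring B] {ι : Type} [LinearOrder ι]
/-- the ordered monomial `∏→ (E p)^(h p)`, the product taken in increasing order of `p`. -/
def ordMon (E : ι → B) (h : ι →₀ ℕ) : B := ((h.support.sort (· ≤ ·)).map (fun p => E p ^ h p)).prod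
end Mon

/-- the subring `ℤ[v,v⁻¹] ⊆ ℚ(v)`. -/
def Rint : Subring KK := Subring.closure {vv, vv⁻¹}

section Forms
variable {B : Type} [Ring B] [Algebra KK B]
/-- the `ℤ[v,v⁻¹]`-subalgebra of a `ℚ(v)`-algebra generated by a set `X`, realized as the subring
generated by `X` together with the central scalars `v^{±1}`. -/
def zvForm (X : Set B) : Subring B :=
  Subring.closure ({algebraMap KK B vv, algebraMap KK B vv⁻¹} ∪ X)
end Forms

/-! ### Positive roots of type `D_n` with the fixed convex (lexicographic) order -/

section RootsD
variable (n : ℕ)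

/-- Positive roots of type `D_n`, encoded as lexicographically ordered pairs `(i,t)`:
`[i,i+t]` for `i+t<n` or `i=n`; `[i,n]` for `i+t=n`; `[i,n,n-1]` for `i+t=n+1`;
`[i,n,j]` with `j = 2n-i-t` for `i+t ≥ n+2`.  The induced linear order is exactly the
convex order coming from standard Lyndon words. -/
def IsPosRootD (p : Fin (n + 1) ×ₗ Fin (2 * n + 1)) : Prop :=
  1 ≤ ((ofLex p).1 : ℕ) ∧ (n - 1 ≤ ((ofLex p).1 : ℕ) → ((ofLex p).2 : ℕ) = 0) ∧
    (((ofLex p).2 : ℕ) = 0 ∨ ((ofLex p).2 : ℕ) + 2 * ((ofLex p).1 : ℕ) + 1 ≤ 2 * n)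

instance : DecidablePred (IsPosRootD n) := fun p => by unfold IsPosRootD; infer_instance

/-- the set `Δ⁺` of positive roots of type `D_n`, with its convex linear order. -/
abbrev PosRootD := {p : Fin (n + 1) ×ₗ Fin (2 * n + 1) // IsPosRootD n p}

variable {n}
/-- the first index `i` of a positive root. -/
def riD (β : PosRootD n) : ℕ := ((ofLex β.1).1 : ℕ)
/-- the offset `t` of a positive root within its block. -/
def rtD (β : PosRootD n) : ℕ := ((ofLex β.1).2 : ℕ)

/-- multiplicity of `α_c` (1-based color `c`) in the positive root `β` (type `D_n`). -/
def nuD (β : PosRootD n) (c : ℕ) : ℕ :=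
  let i := riD β; let t := rtD β
  if i + t < n ∨ i = n then (if i ≤ c ∧ c ≤ i + t then 1 else 0)
  else if i + t = n then (if (i ≤ c ∧ c ≤ n - 2) ∨ c = n then 1 else 0)
  else if i + t = n + 1 then (if i ≤ c ∧ c ≤ n then 1 else 0)
  else (if i ≤ c ∧ c < 2 * n - i - t then 1
        else if 2 * n - i - t ≤ c ∧ c ≤ n - 2 then 2
        else if c = n - 1 ∨ c = n then 1 else 0)

/-- standard Lyndon word (list of 1-based simple-root indices) of `β` (type `D_n`). -/
def wordD (β : PosRootD n) : List ℕ :=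
  let i := riD β; let t := rtD β
  if i + t < n ∨ i = n then List.range' i (t + 1)
  else if i + t = n then List.range' i (n - 1 - i) ++ [n]
  else if i + t = n + 1 then List.range' i (n - 1 - i) ++ [n, n - 1]
  else List.range' i (n - 1 - i) ++ [n] ++ (List.range' (2 * n - i - t) (n - (2 * n - i - t))).reverse

/-- the height `|β|` of a positive root (type `D_n`). -/
def heightD (β : PosRootD n) : ℕ := (wordD β).length

/-- `β` is a root of the form `[i,n,j]` with `i < j ≤ n-2`. -/
def isSpecD (β : PosRootD n) : Prop := n + 2 ≤ riD β + rtD β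
instance (β : PosRootD n) : Decidable (isSpecD β) := by unfold isSpecD; infer_instance
end RootsD

/-! ### General quantum root vectors of type `D_n` -/

section RVD
variable (n : ℕ)

/-- the positive subalgebra `U_v^>(Lo_{2n})`. -/
abbrev UD := UA n (aD n) (dD n)
/-- generators of `U_v^>(Lo_{2n})` with 1-based indices. -/
def genD : ℕ → ℤ → UD n := g1 n (aD n) (dD n)

variable {n}
/-- `E` is a quantum root vector `E_{β,s}` of type `D_n` for some choice of the parameters
`λ_k ∈ v^ℤ` and of a decomposition of `s`: an iterated `q`-bracket along the standard Lyndon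
word of `β`. -/
def IsRVD (β : PosRootD n) (s : ℤ) (E : UD n) : Prop :=
  ∃ (ss : List ℤ) (ls : List KK),
    ss.length = (wordD β).length ∧ ls.length + 1 = (wordD β).length ∧ ss.sum = s ∧
    (∀ l ∈ ls, IsVpow l) ∧ E = chainE (genD n) (wordD β) ss ls
end RVD

/-! ### The specific quantum root vectors `Ẽ^ε_{β,s}` of type `D_n` -/

section TildeD
variable {n : ℕ}

/-- the specific quantum root vector `Ẽ^ε_{β,s}` of type `D_n`, determined by the sign `ε`
and the decomposition data `t` (assigning `s_ℓ` to each 1-based index `ℓ`); all `q`-bracket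
parameters equal `v^{±1}`. -/
def tildeED (ε : Bool) (β : PosRootD n) (t : ℕ → ℤ) : UD n :=
  chainE (genD (n := n)) (wordD β) ((wordD β).map t)
    (List.replicate ((wordD β).length - 1) (vpow (sgn ε)))

/-- the value `s` represented by the decomposition data `t` for the root `β` (type `D_n`). -/
def sOfD (β : PosRootD n) (t : ℕ → ℤ) : ℤ := ((wordD β).map t).sum

/-- the normalized divided power `Ẽ^{ε,(k)}_{β,s} = (Ẽ^ε_{β,s})^k/[k]_v!` of type `D_n`. -/
def tildeEPowD (ε : Bool) (β : PosRootD n) (t : ℕ → ℤ) (k : ℕ) : UD n :=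
  (qFact vv k)⁻¹ • (tildeED ε β t) ^ k

/-- the normalized quantum root vector `𝓔̃^ε_{β,s} = ⟨1⟩_v · Ẽ^ε_{β,s}` of type `D_n`. -/
def rttED (ε : Bool) (β : PosRootD n) (t : ℕ → ℤ) : UD n := qBrack 1 • tildeED ε β t

/-- the Lusztig integral form `𝐔_v^>(Lo_{2n})`: the `ℤ[v,v⁻¹]`-subalgebra generated by the
divided powers `e_{i,r}^k/[k]_v!`. -/
def LusFormD (n : ℕ) : Subring (UD n) :=
  zvForm {x | ∃ (i : Fin n) (r : ℤ) (k : ℕ),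
    x = (qFact vv k)⁻¹ • (ug n (aD n) (dD n) i r) ^ k}

/-- the RTT integral form `𝓤_v^>(Lo_{2n})` attached to a sign `ε` and a choice `T` of
decompositions. -/
def RttFormD (ε : Bool) (T : PosRootD n × ℤ → (ℕ → ℤ)) : Subring (UD n) :=
  zvForm {x | ∃ p : PosRootD n × ℤ, x = rttED ε p.1 (T p)}

end TildeD

/-! ### Pairs of elements satisfying the quantum Serre relations of type `A₂` -/

section SerrePairs
variable {K B : Type*} [Field K] [Ring B] [Algebra K B]

/-- the `u`-commutator over an arbitrary field. -/
def qBr (u : K) (x y : B) : B := x * y - u • (y * x)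

/-- the elements `x, y` satisfy both quantum Serre relations of type `A₂`. -/
structure SerrePair (u : K) (x y : B) : Prop where
  left : x * (x * y) - (u + u⁻¹) • (x * (y * x)) + y * (x * x) = 0
  right : y * (y * x) - (u + u⁻¹) • (y * (x * y)) + x * (y * y) = 0

variable {u : K} {x y z : B}

theorem SerrePair.symm (h : SerrePair u x y) : SerrePair u y x := ⟨h.right, h.left⟩

theorem SerrePair.inv (h : SerrePair u x y) : SerrePair u⁻¹ x y := by
  refine ⟨?_, ?_⟩
  · rw [inv_inv, add_comm u⁻¹ u]; exact h.left
  · rw [inv_inv, add_comm u⁻¹ u]; exact h.right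

theorem SerrePair.mul_qBr (h : SerrePair u x y) (hu : u ≠ 0) :
    x * qBr u x y = u⁻¹ • (qBr u x y * x) := by
  have h1 := h.left
  rw [← sub_eq_zero, ← h1]
  simp only [qBr, mul_sub, sub_mul, mul_smul_comm, smul_mul_assoc, mul_assoc]
  match_scalars <;> field_simp
  ring

theorem SerrePair.qBr_mul (h : SerrePair u x y) (hu : u ≠ 0) :
    qBr u x y * y = u⁻¹ • (y * qBr u x y) := by
  have h1 := h.right
  rw [← sub_eq_zero, ← h1]
  simp only [qBr, mul_sub, sub_mul, mul_smul_comm, smul_mul_assoc, mul_assoc]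
  match_scalars <;> field_simp
  ring

/-- applying the `q`-derivation `[x, ·]` twice to the Serre relation of `z` with `y`. -/
theorem SerrePair.serre_qBr (hu : u ≠ 0) (h2 : u + u⁻¹ ≠ 0) (hxz : SerrePair u x z)
    (hzy : z * (z * y) - (u + u⁻¹) • (z * (y * z)) + y * (z * z) = 0) (hxy : Commute x y) :
    qBr u x z * (qBr u x z * y) - (u + u⁻¹) • (qBr u x z * (y * qBr u x z))
      + y * (qBr u x z * qBr u x z) = 0 := by
  have hE := hxz.mul_qBr hu
  have hz : x * z = qBr u x z + u • (z * x) := by simp [qBr]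
  generalize qBr u x z = E at *
  have hE' : ∀ w, x * (E * w) = u⁻¹ • (E * (x * w)) := fun w => by
    rw [← mul_assoc, hE, smul_mul_assoc, mul_assoc]
  have hz' : ∀ w, x * (z * w) = E * w + u • (z * (x * w)) := fun w => by
    rw [← mul_assoc, hz, add_mul, smul_mul_assoc, mul_assoc]
  have hy : x * y = y * x := hxy
  have hy' : ∀ w, x * (y * w) = y * (x * w) := fun w => by
    rw [← mul_assoc, hy, mul_assoc]
  have key : (u + u⁻¹) • (E * (E * y) - (u + u⁻¹) • (E * (y * E)) + y * (E * E)) = 0 := by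
    have : ∀ S : B, S = 0 →
        x * (x * S) - (u ^ 2 + 1) • (x * (S * x)) + u ^ 2 • (S * (x * x)) = 0 := by
      rintro S rfl; simp
    rw [← this _ hzy]
    simp only [mul_sub, sub_mul, mul_add, add_mul, mul_smul_comm, smul_mul_assoc, mul_assoc,
      hE, hE', hz, hz', hy, hy', smul_add, smul_sub]
    match_scalars <;> field_simp <;> ring
  exact (smul_eq_zero.mp key).resolve_left h2

theorem serre_of_qBr (p q : B) (h : y * (y * p) - (u + u⁻¹) • (y * (p * y)) + p * (y * y) = 0)
    (hq : Commute q y) :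
    y * (y * qBr u q p) - (u + u⁻¹) • (y * (qBr u q p * y)) + qBr u q p * (y * y) = 0 ∧
    y * (y * qBr u p q) - (u + u⁻¹) • (y * (qBr u p q * y)) + qBr u p q * (y * y) = 0 := by
  have hy : q * y = y * q := hq
  have hy' : ∀ w, q * (y * w) = y * (q * w) := fun w => by rw [← mul_assoc, hy, mul_assoc]
  have : ∀ S : B, S = 0 → q * S - u • (S * q) = 0 ∧ S * q - u • (q * S) = 0 := by
    rintro S rfl; simp
  obtain ⟨h1, h2⟩ := this _ h
  refine ⟨?_, ?_⟩
  · rw [← h1]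
    simp only [qBr, mul_sub, sub_mul, mul_add, add_mul, mul_smul_comm, smul_mul_assoc, mul_assoc,
      hy, hy', smul_add, smul_sub]
    module
  · rw [← h2]
    simp only [qBr, mul_sub, sub_mul, mul_add, add_mul, mul_smul_comm, smul_mul_assoc, mul_assoc,
      hy, hy', smul_add, smul_sub]
    module

/-- extending a chain `x — z` by a node `y` attached to `z`. -/
theorem SerrePair.qBr_of_right (hu : u ≠ 0) (h2 : u + u⁻¹ ≠ 0) (hxz : SerrePair u x z)
    (hzy : SerrePair u z y) (hxy : Commute x y) : SerrePair u (qBr u x z) y :=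
  ⟨hxz.serre_qBr hu h2 hzy.left hxy, (serre_of_qBr z x hzy.right hxy).1⟩

/-- extending a chain `x — z` by a node `y` attached to `x`. -/
theorem SerrePair.qBr_of_left (hu : u ≠ 0) (h2 : u + u⁻¹ ≠ 0) (hxz : SerrePair u x z)
    (hxy : SerrePair u x y) (hzy : Commute z y) : SerrePair u (qBr u x z) y := by
  refine ⟨?_, (serre_of_qBr x z hxy.right hzy).2⟩
  have h := hxz.symm.inv.serre_qBr (inv_ne_zero hu) (by rwa [inv_inv, add_comm]) hxy.inv.left hzy
  have hE : qBr u x z = (-u) • qBr u⁻¹ z x := by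
    simp only [qBr, smul_sub, smul_smul]
    match_scalars <;> field_simp
  have h' := congrArg (fun w => u ^ 2 • w) h
  simp only [smul_zero, inv_inv] at h'
  rw [hE, ← h']
  simp only [mul_smul_comm, smul_mul_assoc, smul_add, smul_sub]
  match_scalars <;> field_simp
  ring

/-- in a chain `q — e — f`, the root vector of the sum commutes with the middle node. -/
theorem SerrePair.commute_qBr_qBr {q e f : B} (hu : u ≠ 0) (h2 : u + u⁻¹ ≠ 0)
    (hqe : SerrePair u q e) (hef : SerrePair u e f) (hqf : Commute q f) :
    Commute (qBr u (qBr u q e) f) e := by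
  have hf : q * f = f * q := hqf
  have hf' : ∀ w, q * (f * w) = f * (q * w) := fun w => by rw [← mul_assoc, hf, mul_assoc]
  have key : (u + u⁻¹) • (qBr u (qBr u q e) f * e - e * qBr u (qBr u q e) f) = 0 := by
    have : ∀ S T : B, S = 0 → T = 0 →
        S * f - u ^ 2 • (f * S) + u ^ 2 • (T * q) - q * T = 0 := by
      rintro S T rfl rfl; simp
    rw [← this _ _ hqe.right hef.left]
    simp only [qBr, mul_sub, sub_mul, mul_add, add_mul, mul_smul_comm, smul_mul_assoc, mul_assoc,
      hf, hf', smul_add, smul_sub]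
    match_scalars <;> field_simp <;> ring
  exact sub_eq_zero.mp ((smul_eq_zero.mp key).resolve_left h2)

theorem commute_qBr {w : B} (hx : Commute x w) (hy : Commute y w) : Commute (qBr u x y) w :=
  (hx.mul_left hy).sub_left ((hy.mul_left hx).smul_left u)

end SerrePairs

/-! ### Divided powers of `q`-brackets -/

section DividedPowers
variable {K B : Type*} [Field K] [Ring B] [Algebra K B]

/-- the quantum integer `[m]_u` for `m ∈ ℤ`. -/
def qIntZ (u : K) (m : ℤ) : K := (u ^ m - u ^ (-m)) / (u - u⁻¹)

/-- the quantum factorial over an arbitrary field. -/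
def qFactZ (u : K) (m : ℕ) : K := ∏ k ∈ Finset.range m, qIntZ u (k + 1)

/-- the divided power `x^m/[m]_u!`, set to `0` for negative `m`. -/
def divPow (u : K) (x : B) (m : ℤ) : B := if 0 ≤ m then (qFactZ u m.toNat)⁻¹ • x ^ m.toNat else 0

variable {u : K} {x y : B}

theorem divPow_of_neg {m : ℤ} (h : m < 0) : divPow u x m = 0 := if_neg (by omega)

theorem divPow_natCast (m : ℕ) : divPow u x m = (qFactZ u m)⁻¹ • x ^ m := by simp [divPow]

theorem divPow_zero : divPow u x 0 = 1 := by simp [divPow, qFactZ]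

theorem qIntZ_ne_zero (hu : ∀ m : ℕ, u ^ (m + 1 : ℤ) ≠ u ^ (-(m + 1 : ℤ))) (m : ℕ) :
    qIntZ u (m + 1) ≠ 0 :=
  div_ne_zero (sub_ne_zero.mpr (hu m)) (sub_ne_zero.mpr (by simpa using hu 0))

theorem qFactZ_ne_zero (hu : ∀ m : ℕ, u ^ (m + 1 : ℤ) ≠ u ^ (-(m + 1 : ℤ))) (m : ℕ) :
    qFactZ u m ≠ 0 :=
  Finset.prod_ne_zero_iff.mpr fun k _ => qIntZ_ne_zero hu k

theorem mul_divPow (hu : ∀ m : ℕ, u ^ (m + 1 : ℤ) ≠ u ^ (-(m + 1 : ℤ))) (m : ℤ) :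
    x * divPow u x m = qIntZ u (m + 1) • divPow u x (m + 1) := by
  rcases lt_or_ge m 0 with h | h
  · rw [divPow_of_neg h, mul_zero]
    rcases eq_or_ne m (-1) with rfl | h'
    · simp [qIntZ]
    · rw [divPow_of_neg (by omega), smul_zero]
  · obtain ⟨m, rfl⟩ := Int.eq_ofNat_of_zero_le h
    have h3 : ((m : ℤ) + 1) = ((m + 1 : ℕ) : ℤ) := by push_cast; rfl
    rw [divPow_natCast, h3, divPow_natCast, mul_smul_comm, ← pow_succ', smul_smul]
    congr 1
    rw [qFactZ, qFactZ, Finset.prod_range_succ]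
    have h1 := qIntZ_ne_zero hu m
    have h2 := qFactZ_ne_zero hu m
    rw [qFactZ] at h2
    push_cast
    field_simp

theorem divPow_mul_self (m : ℤ) : divPow u x m * x = x * divPow u x m := by
  unfold divPow
  split_ifs
  · rw [smul_mul_assoc, mul_smul_comm, pow_mul_comm']
  · simp

theorem mul_divPow_of_qComm {c : K} (h : x * y = c • (y * x)) (m : ℤ) :
    x * divPow u y m = c ^ m • (divPow u y m * x) := by
  rcases lt_or_ge m 0 with h' | h'
  · simp [divPow_of_neg h']
  · obtain ⟨m, rfl⟩ := Int.eq_ofNat_of_zero_le h'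
    simp only [zpow_natCast, divPow_natCast]
    have : x * y ^ m = c ^ m • (y ^ m * x) := by
      induction m with
      | zero => simp
      | succ m ih =>
        rw [pow_succ, ← mul_assoc, ih (by omega), smul_mul_assoc, mul_assoc, h, mul_smul_comm, smul_smul,
          ← mul_assoc, ← pow_succ]
    rw [mul_smul_comm, this, smul_mul_assoc, smul_comm]

variable (hu0 : u ≠ 0) (hu : ∀ m : ℕ, u ^ (m + 1 : ℤ) ≠ u ^ (-(m + 1 : ℤ)))
include hu0 hu

theorem SerrePair.mul_divPow (h : SerrePair u x y) (m : ℤ) :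
    x * divPow u y m = u ^ m • (divPow u y m * x) + divPow u y (m - 1) * qBr u x y := by
  rcases lt_or_ge m 0 with h' | h'
  · simp [divPow_of_neg h', divPow_of_neg (show m - 1 < 0 by omega)]
  · obtain ⟨m, rfl⟩ := Int.eq_ofNat_of_zero_le h'
    induction m with
    | zero => simp [divPow_zero, divPow_of_neg]
    | succ m ih =>
      have ih := ih (by omega)
      have hE := h.qBr_mul hu0
      have hz : x * y = qBr u x y + u • (y * x) := by simp [qBr]
      generalize qBr u x y = E at *
      have hne := qIntZ_ne_zero hu m
      have h1 := _root_.mul_divPow (x := y) hu m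
      have h2 := _root_.mul_divPow (x := y) hu (m - 1)
      rw [sub_add_cancel] at h2
      have hd : u - u⁻¹ ≠ 0 := sub_ne_zero.mpr (by simpa using hu 0)
      push_cast
      rw [add_sub_cancel_right]
      refine smul_right_injective B hne ?_
      have hum : u ^ (m : ℤ) ≠ 0 := zpow_ne_zero _ hu0
      have e1 : qIntZ u (m + 1) • (x * divPow u y (m + 1)) = x * divPow u y m * y := by
        rw [mul_assoc, divPow_mul_self, h1, mul_smul_comm]
      have e2 : qIntZ u (m + 1) • (divPow u y (m + 1) * x) = divPow u y m * (y * x) := by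
        rw [← mul_assoc, divPow_mul_self, h1, smul_mul_assoc]
      have e3 : divPow u y (m - 1) * (y * E) = qIntZ u m • (divPow u y m * E) := by
        rw [← mul_assoc, divPow_mul_self, h2, smul_mul_assoc]
      simp only [smul_add]
      rw [e1, ih, smul_comm (qIntZ u (m + 1)), e2, add_mul, smul_mul_assoc, mul_assoc, mul_assoc,
        hE, hz, mul_add, mul_smul_comm, mul_smul_comm, e3]
      have hq : qIntZ u (m + 1) = u ^ (m : ℤ) + u⁻¹ * qIntZ u m := by
        unfold qIntZ
        rw [neg_add, zpow_add₀ hu0, zpow_add₀ hu0]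
        simp only [zpow_neg, zpow_one]
        have hd' : u ^ 2 - 1 ≠ 0 := fun h0 => hd (by field_simp; rw [h0, mul_zero])
        field_simp
        ring
      rw [hq, zpow_add₀ hu0, zpow_one]
      module

/-- the straightening formula for divided powers in type `A₂`. -/
theorem SerrePair.divPow_mul_divPow (h : SerrePair u x y) (m k : ℕ) :
    divPow u x m * divPow u y k = ∑ j ∈ Finset.range (k + 1),
      u ^ (((m : ℤ) - j) * (k - j)) •
        (divPow u y (k - j) * (divPow u (qBr u x y) j * divPow u x (m - j))) := by
  induction m with
  | zero =>
    rw [Finset.sum_eq_single 0]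
    · simp [divPow_zero]
    · intro j _ hj
      rw [divPow_of_neg (x := x) (by omega)]
      simp
    · simp
  | succ m ih =>
    have hne := qIntZ_ne_zero hu m
    refine smul_right_injective B hne ?_
    have h1 := _root_.mul_divPow (x := x) hu m
    have hd : u - u⁻¹ ≠ 0 := sub_ne_zero.mpr (by simpa using hu 0)
    push_cast
    simp only [← smul_mul_assoc]
    rw [← h1, mul_assoc, ih, Finset.mul_sum, Finset.smul_sum]
    have hEx := fun j => mul_divPow_of_qComm (u := u) (h.mul_qBr hu0) j
    have hxy := fun j => h.mul_divPow hu0 hu j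
    have hE := fun j => _root_.mul_divPow (x := qBr u x y) hu j
    generalize qBr u x y = E at *
    have step : ∀ j ∈ Finset.range (k + 1),
        x * u ^ (((m : ℤ) - j) * (k - j)) •
          (divPow u y (k - j) * (divPow u E j * divPow u x (m - j))) =
        (u ^ (((m : ℤ) + 1 - j) * (k - j) - j) * qIntZ u (m + 1 - j)) •
          (divPow u y (k - j) * (divPow u E j * divPow u x (m + 1 - j))) +
        (u ^ (((m : ℤ) - j) * (k - j)) * qIntZ u (j + 1)) •
          (divPow u y (k - (j + 1 : ℕ)) *
            (divPow u E (j + 1 : ℕ) * divPow u x (m + 1 - (j + 1 : ℕ)))) := by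
      intro j _
      have a1 : x * (divPow u y (k - j) * (divPow u E j * divPow u x (m - j))) =
          (u ^ ((k : ℤ) - j) * u⁻¹ ^ (j : ℤ) * qIntZ u (m + 1 - j)) •
            (divPow u y (k - j) * (divPow u E j * divPow u x (m + 1 - j))) +
          qIntZ u (j + 1) • (divPow u y (k - j - 1) *
            (divPow u E (j + 1) * divPow u x (m - j))) := by
        have b1 : x * (divPow u E j * divPow u x (m - j)) =
            (u⁻¹ ^ (j : ℤ) * qIntZ u (m + 1 - j)) •
              (divPow u E j * divPow u x (m + 1 - j)) := by
          rw [← mul_assoc, hEx, smul_mul_assoc, mul_assoc, _root_.mul_divPow hu,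
            show (m : ℤ) - j + 1 = m + 1 - j by ring, mul_smul_comm, smul_smul]
        have b2 : E * (divPow u E j * divPow u x (m - j)) =
            qIntZ u (j + 1) • (divPow u E (j + 1) * divPow u x (m - j)) := by
          rw [← mul_assoc, hE, smul_mul_assoc]
        rw [← mul_assoc, hxy, add_mul, smul_mul_assoc, mul_assoc, mul_assoc, b1, b2,
          mul_smul_comm, mul_smul_comm, smul_smul, mul_assoc]
      rw [mul_smul_comm, a1, smul_add, smul_smul, smul_smul]
      have c1 : u ^ (((m : ℤ) - j) * (k - j)) *
          (u ^ ((k : ℤ) - j) * u⁻¹ ^ (j : ℤ) * qIntZ u (m + 1 - j)) =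
          u ^ (((m : ℤ) + 1 - j) * (k - j) - j) * qIntZ u (m + 1 - j) := by
        rw [inv_zpow', ← mul_assoc, ← zpow_add₀ hu0, ← zpow_add₀ hu0]
        congr 2
        ring
      rw [c1]
      push_cast
      rw [sub_sub, add_sub_add_right_eq_sub]
    set G : ℕ → B := fun j => (u ^ (((m : ℤ) + 1 - j) * (k - j + 1)) * qIntZ u j) •
      (divPow u y (k - j) * (divPow u E j * divPow u x (m + 1 - j))) with hG
    have step' : ∀ j : ℕ, (u ^ (((m : ℤ) - j) * (k - j)) * qIntZ u (j + 1)) •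
          (divPow u y (k - (j + 1 : ℕ)) *
            (divPow u E (j + 1 : ℕ) * divPow u x (m + 1 - (j + 1 : ℕ)))) = G (j + 1) := by
      intro j
      rw [hG]
      push_cast
      rw [add_sub_add_right_eq_sub, show (k : ℤ) - (j + 1) + 1 = k - j by ring]
    have hG0 : G 0 = 0 := by simp [hG, qIntZ]
    have hGk : G (k + 1) = 0 := by simp [hG, divPow_of_neg]
    have hshift : ∑ j ∈ Finset.range (k + 1), G (j + 1) = ∑ j ∈ Finset.range (k + 1), G j := by
      have := Finset.sum_range_succ' G (k + 1)
      rw [Finset.sum_range_succ, hG0, hGk, add_zero, add_zero] at this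
      exact this.symm
    rw [Finset.sum_congr rfl step, Finset.sum_add_distrib, Finset.sum_congr rfl fun j _ => step' j,
      hshift, ← Finset.sum_add_distrib]
    refine Finset.sum_congr rfl fun j _ => ?_
    rw [hG, ← add_smul, smul_mul_assoc, smul_smul]
    congr 1
    unfold qIntZ
    have e1 : ((m : ℤ) + 1 - j) * (k - j + 1) = (m + 1 - j) * (k - j) + (m + 1) - j := by ring
    rw [e1]
    generalize ((m : ℤ) + 1 - j) * (k - j) = c
    rw [neg_sub]
    simp only [zpow_sub₀ hu0, zpow_add₀ hu0 c, zpow_neg]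
    have n1 : u ^ (j : ℤ) ≠ 0 := zpow_ne_zero _ hu0
    have n2 : u ^ ((m : ℤ) + 1) ≠ 0 := zpow_ne_zero _ hu0
    generalize u ^ (j : ℤ) = a at *
    generalize u ^ ((m : ℤ) + 1) = b at *
    field_simp
    ring

/-- if all divided powers of a Serre pair lie in a subring stable under `u^{±1}`, then so do all
divided powers of their `u`-commutator. -/
theorem SerrePair.divPow_qBr_mem (h : SerrePair u x y) (S : Subring B)
    (hS : ∀ (c : ℤ), ∀ w ∈ S, u ^ c • w ∈ S) (hx : ∀ k : ℕ, divPow u x k ∈ S)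
    (hy : ∀ k : ℕ, divPow u y k ∈ S) (k : ℕ) : divPow u (qBr u x y) k ∈ S := by
  induction k using Nat.strong_induction_on with
  | _ k ih =>
    have hk := h.divPow_mul_divPow hu0 hu k k
    rw [Finset.sum_range_succ] at hk
    simp only [sub_self, divPow_zero, mul_one, one_mul, mul_zero, zpow_zero,
      one_smul] at hk
    rw [← sub_eq_iff_eq_add'.mpr hk]
    refine S.sub_mem (S.mul_mem (hx k) (hy k)) (S.sum_mem fun j hj => ?_)
    have hjk := Finset.mem_range.mp hj
    rw [← Nat.cast_sub hjk.le]
    exact hS _ _ (S.mul_mem (hy _) (S.mul_mem (ih j hjk) (hx _)))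

end DividedPowers

/-! ### Iterated `q`-brackets along type `D` words -/

theorem reverse_range'_eq {n j : ℕ} (hj : j < n) :
    (List.range' j (n - j)).reverse = (List.range' (j + 1) (n - (j + 1))).reverse ++ [j] := by
  rw [show n - j = n - (j + 1) + 1 by omega, List.range'_succ, List.reverse_cons]

section TypeD
variable {K B : Type*} [Field K] [Ring B] [Algebra K B]

/-- the iterated `u`-commutator of `x` with the letters `e j`, `j ∈ l`. -/
def qChain (u : K) (e : ℕ → B) (x : B) (l : List ℕ) : B :=
  l.foldl (fun acc j => qBr u acc (e j)) x

/-- the elements `e 1, …, e n` satisfy the quantum Serre relations of type `D_n`. -/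
structure IsTypeD (u : K) (n : ℕ) (e : ℕ → B) : Prop where
  path : ∀ i, 1 ≤ i → i + 2 ≤ n → SerrePair u (e i) (e (i + 1))
  branch : SerrePair u (e (n - 2)) (e n)
  comm : ∀ i j, 1 ≤ i → i + 2 ≤ j → j ≤ n → (j = n → i + 3 ≤ n) → Commute (e i) (e j)
  last : Commute (e (n - 1)) (e n)

variable {u : K} {e : ℕ → B} {x w : B}

theorem qChain_concat (l : List ℕ) (j : ℕ) :
    qChain u e x (l ++ [j]) = qBr u (qChain u e x l) (e j) := by
  simp [qChain]

theorem qChain_append (l l' : List ℕ) :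
    qChain u e x (l ++ l') = qChain u e (qChain u e x l) l' := by
  simp [qChain]

theorem commute_qChain {l : List ℕ} (hx : Commute x w) (hl : ∀ j ∈ l, Commute (e j) w) :
    Commute (qChain u e x l) w := by
  induction l using List.reverseRecOn with
  | nil => exact hx
  | append_singleton l j ih =>
    rw [qChain_concat]
    exact commute_qBr (ih fun i hi => hl i (by simp [hi])) (hl j (by simp))

variable {n : ℕ} (h : IsTypeD u n e) (hu0 : u ≠ 0) (h2 : u + u⁻¹ ≠ 0)
include hu0 h2

theorem SerrePair.qChain_range' {i m : ℕ} {y : B}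
    (hpath : ∀ l, i ≤ l → l < i + m → SerrePair u (e l) (e (l + 1)))
    (hcomm : ∀ l k, i ≤ l → l + 2 ≤ k → k ≤ i + m → Commute (e l) (e k))
    (hy : SerrePair u (e (i + m)) y) (hcy : ∀ l, i ≤ l → l < i + m → Commute (e l) y) :
    SerrePair u (qChain u e (e i) (List.range' (i + 1) m)) y := by
  induction m generalizing y with
  | zero => exact hy
  | succ m ih =>
    rw [List.range'_1_concat, qChain_concat, show i + 1 + m = i + (m + 1) by omega]
    refine SerrePair.qBr_of_right hu0 h2 ?_ hy ?_
    · exact ih (fun l h1 h2 => hpath l h1 (by omega))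
        (fun l k h1 h2 h3 => hcomm l k h1 h2 (by omega))
        (hpath (i + m) (by omega) (by omega))
        (fun l h1 h2 => hcomm l _ h1 (by omega) (by omega))
    · refine commute_qChain (hcy i le_rfl (by omega)) fun j hj => ?_
      rw [List.mem_range'_1] at hj
      exact hcy j (by omega) (by omega)

include h

theorem IsTypeD.serrePair_path {i m : ℕ} {y : B} (hi : 1 ≤ i) (him : i + m + 1 ≤ n)
    (hy : SerrePair u (e (i + m)) y) (hcy : ∀ l, i ≤ l → l < i + m → Commute (e l) y) :
    SerrePair u (qChain u e (e i) (List.range' (i + 1) m)) y :=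
  SerrePair.qChain_range' hu0 h2 (fun l h1 h2 => h.path l (by omega) (by omega))
    (fun l k h1 h2 h3 => h.comm l k (by omega) h2 (by omega) (by omega)) hy hcy

/-- the chain `i, …, i+m+1, f` commutes with its last node `e (i+m+1)` before `f`. -/
theorem IsTypeD.commute_fork {i m : ℕ} {f : B} (hi : 1 ≤ i) (him : i + m + 2 ≤ n)
    (hf : SerrePair u (e (i + m + 1)) f) (hcf : ∀ l, i ≤ l → l ≤ i + m → Commute (e l) f) :
    Commute (qBr u (qChain u e (e i) (List.range' (i + 1) (m + 1))) f) (e (i + m + 1)) := by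
  rw [List.range'_1_concat, qChain_concat, show i + 1 + m = i + m + 1 by omega]
  refine SerrePair.commute_qBr_qBr hu0 h2 ?_ hf ?_
  · exact h.serrePair_path hu0 h2 hi (by omega) (h.path _ (by omega) (by omega))
      fun l h1 h2 => h.comm l _ (by omega) (by omega) (by omega) (by omega)
  · refine commute_qChain (hcf i le_rfl (by omega)) fun j hj => ?_
    rw [List.mem_range'_1] at hj
    exact hcf j (by omega) (by omega)

/-- the chain `i, …, n-2, n` commutes with every `e l`, `i < l ≤ n - 2`. -/
theorem IsTypeD.commute_chain_last {i l : ℕ} (hi : 1 ≤ i) (hil : i < l) (hl : l + 2 ≤ n) :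
    Commute (qBr u (qChain u e (e i) (List.range' (i + 1) (n - 2 - i))) (e n)) (e l) := by
  obtain ⟨m, rfl⟩ : ∃ m, l = i + m + 1 := ⟨l - i - 1, by omega⟩
  rcases Nat.lt_or_ge (i + m + 1 + 2) n with hlt | hge
  · refine commute_qBr ?_ (h.comm _ n (by omega) (by omega) le_rfl (by omega)).symm
    have hsplit : List.range' (i + 1) (n - 2 - i) =
        List.range' (i + 1) (m + 1) ++ [i + m + 2] ++ List.range' (i + m + 3) (n - i - m - 4) := by
      rw [show n - 2 - i = (m + 1) + (n - i - m - 4 + 1) by omega, ← List.range'_append_1,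
        List.append_assoc, List.singleton_append, show i + 1 + (m + 1) = i + m + 2 by omega]
      exact congrArg _ List.range'_succ
    rw [hsplit, qChain_append, qChain_concat]
    refine commute_qChain (h.commute_fork hu0 h2 hi (by omega)
      (h.path _ (by omega) (by omega))
      fun l h1 h2 => h.comm l _ (by omega) (by omega) (by omega) (by omega)) fun j hj => ?_
    rw [List.mem_range'_1] at hj
    exact (h.comm _ j (by omega) (by omega) (by omega) (by omega)).symm
  · have hm : n - 2 - i = m + 1 := by omega
    rw [hm]
    refine h.commute_fork hu0 h2 hi (by omega) ?_ fun l h1 h2 => ?_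
    · have := h.branch
      rwa [show n - 2 = i + m + 1 by omega] at this
    · exact h.comm l n (by omega) (by omega) le_rfl (by omega)

/-- the chain `i, …, n-2, n, n-1, …, j` commutes with every `e l`, `i < l ≤ j - 2`. -/
theorem IsTypeD.commute_chain_reverse {i l j : ℕ} (hi : 1 ≤ i) (hil : i < l) (hl : l + 2 ≤ n)
    (hlj : l + 2 ≤ j) :
    Commute (qChain u e (qBr u (qChain u e (e i) (List.range' (i + 1) (n - 2 - i))) (e n))
      (List.range' j (n - j)).reverse) (e l) := by
  refine commute_qChain (h.commute_chain_last hu0 h2 hi hil hl) fun k hk => ?_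
  rw [List.mem_reverse, List.mem_range'_1] at hk
  exact (h.comm l k (by omega) (by omega) (by omega) (by omega)).symm

theorem IsTypeD.serrePair_chain_last {i : ℕ} (hi : 1 ≤ i) (hin : i + 2 ≤ n) :
    SerrePair u (qChain u e (e i) (List.range' (i + 1) (n - 2 - i))) (e n) := by
  refine h.serrePair_path hu0 h2 hi (by omega) ?_
    fun l h1 h2 => h.comm l n (by omega) (by omega) le_rfl (by omega)
  rw [show i + (n - 2 - i) = n - 2 by omega]
  exact h.branch

theorem IsTypeD.serrePair_chain_reverse {i d : ℕ} (hi : 1 ≤ i) (hd : i + d + 2 ≤ n) :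
    SerrePair u (qChain u e (qBr u (qChain u e (e i) (List.range' (i + 1) (n - 2 - i))) (e n))
      (List.range' (n - d) (n - (n - d))).reverse) (e (n - d - 1)) := by
  induction d with
  | zero =>
    have h1 : SerrePair u (qChain u e (e i) (List.range' (i + 1) (n - 2 - i))) (e (n - 1)) := by
      refine h.serrePair_path hu0 h2 hi (by omega) ?_
        fun l h1 h2 => h.comm l _ (by omega) (by omega) (by omega) (by omega)
      have := h.path (n - 2) (by omega) (by omega)
      rwa [show n - 2 + 1 = n - 1 by omega, show n - 2 = i + (n - 2 - i) by omega] at this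
    simpa [qChain] using (h.serrePair_chain_last hu0 h2 hi (by omega)).qBr_of_left hu0 h2 h1
      h.last.symm
  | succ d ih =>
    rw [reverse_range'_eq (by omega), qChain_concat,
      show n - (d + 1) + 1 = n - d by omega, show n - (d + 1) = n - d - 1 by omega]
    refine (ih (by omega)).qBr_of_right hu0 h2 ?_ ?_
    · have := h.path (n - d - 1 - 1) (by omega) (by omega)
      rw [show n - d - 1 - 1 + 1 = n - d - 1 by omega] at this
      exact this.symm
    · exact h.commute_chain_reverse hu0 h2 hi (by omega) (by omega) (by omega)

variable (hu : ∀ m : ℕ, u ^ (m + 1 : ℤ) ≠ u ^ (-(m + 1 : ℤ))) {S : Subring B}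
  (hS : ∀ (c : ℤ), ∀ w ∈ S, u ^ c • w ∈ S)
  (he : ∀ i, 1 ≤ i → i ≤ n → ∀ k : ℕ, divPow u (e i) k ∈ S)
include hu hS he

theorem IsTypeD.divPow_path_mem {i m : ℕ} (hi : 1 ≤ i) (him : i + m + 1 ≤ n) (k : ℕ) :
    divPow u (qChain u e (e i) (List.range' (i + 1) m)) k ∈ S := by
  induction m generalizing k with
  | zero => exact he i hi (by omega) k
  | succ m ih =>
    rw [List.range'_1_concat, qChain_concat, show i + 1 + m = i + m + 1 by omega]
    refine SerrePair.divPow_qBr_mem hu0 hu ?_ S hS (ih (by omega)) (he _ (by omega) (by omega)) k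
    exact h.serrePair_path hu0 h2 hi (by omega) (h.path _ (by omega) (by omega))
      fun l h1 h2 => h.comm l _ (by omega) (by omega) (by omega) (by omega)

theorem IsTypeD.divPow_reverse_mem {i d : ℕ} (hi : 1 ≤ i) (hin : i + 2 ≤ n) (hd : i + d + 1 ≤ n)
    (k : ℕ) :
    divPow u (qChain u e (qBr u (qChain u e (e i) (List.range' (i + 1) (n - 2 - i))) (e n))
      (List.range' (n - d) (n - (n - d))).reverse) k ∈ S := by
  induction d generalizing k with
  | zero =>
    simpa [qChain] using (h.serrePair_chain_last hu0 h2 hi hin).divPow_qBr_mem hu0 hu S hS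
      (h.divPow_path_mem hu0 h2 hu hS he hi (by omega)) (he n (by omega) le_rfl) k
  | succ d ih =>
    have hp := h.serrePair_chain_reverse hu0 h2 hi (show i + d + 2 ≤ n by omega)
    rw [reverse_range'_eq (by omega), qChain_concat,
      show n - (d + 1) + 1 = n - d by omega, show n - (d + 1) = n - d - 1 by omega]
    exact hp.divPow_qBr_mem hu0 hu S hS (ih (by omega)) (he _ (by omega) (by omega)) k

end TypeD

/-! ### The quantum root vectors of the loop algebra -/

section Loop
variable {n : ℕ}

theorem vv_zpow_ne (m : ℕ) : vv ^ (m + 1 : ℤ) ≠ vv ^ (-(m + 1 : ℤ)) := by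
  have hv : vv ≠ 0 := RatFunc.X_ne_zero
  intro h
  have h1 : vv ^ (2 * (m + 1)) = 1 := by
    have h2 := congrArg (fun w => w * vv ^ (m + 1 : ℤ)) h
    simp only [← zpow_add₀ hv, neg_add_cancel, zpow_zero] at h2
    rw [← zpow_natCast, ← h2]
    push_cast
    ring_nf
  have h3 := congrArg RatFunc.intDegree h1
  rw [RatFunc.intDegree_one] at h3
  have h4 : ∀ k : ℕ, RatFunc.intDegree (vv ^ k) = k := by
    intro k
    induction k with
    | zero => simp
    | succ k ih =>
      rw [pow_succ, RatFunc.intDegree_mul (pow_ne_zero _ hv) hv, ih]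
      simp [vv]
  rw [h4] at h3
  push_cast at h3
  omega

theorem vpow_sgn_ne_zero (ε : Bool) : vpow (sgn ε) ≠ 0 :=
  zpow_ne_zero _ RatFunc.X_ne_zero

theorem vpow_sgn_zpow_ne (ε : Bool) (m : ℕ) :
    vpow (sgn ε) ^ (m + 1 : ℤ) ≠ vpow (sgn ε) ^ (-(m + 1 : ℤ)) := by
  cases ε
  · have := (vv_zpow_ne m).symm
    simpa [vpow, sgn, -neg_add_rev] using this
  · simpa [vpow, sgn] using vv_zpow_ne m

theorem vpow_sgn_add_inv_eq (ε : Bool) :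
    vpow (sgn ε) + (vpow (sgn ε))⁻¹ = vv + vv⁻¹ := by
  cases ε <;> simp [vpow, sgn, add_comm]

theorem vv_add_inv_ne_zero : vv + vv⁻¹ ≠ 0 := by
  intro h
  have h1 : vv = -vv⁻¹ := eq_neg_of_add_eq_zero_left h
  have h2 := vv_zpow_ne 1
  apply h2
  have h3 : vv ^ (2 : ℤ) = vv⁻¹ ^ (2 : ℤ) := by
    conv_lhs => rw [h1]
    rw [Even.neg_zpow (by decide)]
  rw [inv_zpow'] at h3
  simpa [one_add_one_eq_two] using h3

theorem qFactZ_vpow_sgn (ε : Bool) (k : ℕ) : qFactZ (vpow (sgn ε)) k = qFact vv k := by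
  unfold qFactZ qFact
  refine Finset.prod_congr rfl fun m _ => ?_
  unfold qIntZ qInt
  cases ε
  · have h1 : vpow (sgn false) = vv⁻¹ := by simp [vpow, sgn]
    rw [h1, inv_zpow', inv_zpow', neg_neg, inv_inv, ← neg_sub (vv ^ _), ← neg_sub vv, neg_div_neg_eq]
    push_cast
    rfl
  · have h1 : vpow (sgn true) = vv := by simp [vpow, sgn]
    rw [h1]
    push_cast
    rfl

theorem qInt_one : qInt vv 1 = 1 := by
  unfold qInt
  have : vv - vv⁻¹ ≠ 0 := sub_ne_zero.mpr (by simpa using vv_zpow_ne 0)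
  simpa using div_self this

theorem qInt_two : qInt vv 2 = vv + vv⁻¹ := by
  unfold qInt
  have hv : vv ≠ 0 := RatFunc.X_ne_zero
  have : vv - vv⁻¹ ≠ 0 := sub_ne_zero.mpr (by simpa using vv_zpow_ne 0)
  rw [div_eq_iff this, zpow_neg]
  push_cast
  rw [zpow_ofNat]
  field_simp
  ring

theorem ug_serre (i j : Fin n) (hij : i ≠ j) (r t : ℤ) (m : ℕ)
    (hm : (1 - aD n (i.1 + 1) (j.1 + 1)).toNat = m) :
    RingQuot.mkAlgHom KK (URel n (aD n) (dD n)) (serreElt n (dD n) i j m (fun _ => r) t) = 0 := by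
  subst hm
  rw [RingQuot.mkAlgHom_rel KK (URel.serre (A := aD n) (Dd := dD n) i j hij (fun _ => r) t),
    map_zero]

theorem serre_of_two_mul {K B : Type*} [Field K] [CharZero K] [Ring B] [Algebra K B] {c : K}
    {a b d : B} (h : 2 * a + (-c⁻¹ + -c) • (2 * b) + 2 * d = 0) :
    d - (c + c⁻¹) • b + a = 0 := by
  have h2 : ∀ w : B, 2 * w = (2 : K) • w := fun w => by rw [two_mul, two_smul]
  refine (smul_eq_zero.mp (?_ : (2 : K) • (d - (c + c⁻¹) • b + a) = 0)).resolve_left two_ne_zero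
  rw [h2, h2, h2] at h
  rw [← h]
  module

theorem ug_commute (i j : Fin n) (hij : i ≠ j) (ha : aD n (i.1 + 1) (j.1 + 1) = 0) (r t : ℤ) :
    Commute (ug n (aD n) (dD n) i r) (ug n (aD n) (dD n) j t) := by
  have h := ug_serre i j hij r t 1 (by rw [ha]; rfl)
  simp [serreElt, Finset.sum_range_succ, qBinom, qFact, dD, vpow, qInt_one] at h
  exact (add_neg_eq_zero.mp h).symm

theorem ug_serre_two (i j : Fin n) (hij : i ≠ j) (ha : aD n (i.1 + 1) (j.1 + 1) = -1) (r t : ℤ) :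
    ug n (aD n) (dD n) i r * (ug n (aD n) (dD n) i r * ug n (aD n) (dD n) j t)
      - (vv + vv⁻¹) • (ug n (aD n) (dD n) i r * (ug n (aD n) (dD n) j t * ug n (aD n) (dD n) i r))
      + ug n (aD n) (dD n) j t * (ug n (aD n) (dD n) i r * ug n (aD n) (dD n) i r) = 0 := by
  have h := ug_serre i j hij r t 2 (by rw [ha]; rfl)
  simp [serreElt, Finset.sum_range_succ, Finset.prod_range_succ, qBinom, qFact, dD, vpow,
    qInt_one, qInt_two, div_self vv_add_inv_ne_zero, Fintype.card_perm] at h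
  rw [map_ofNat] at h
  rw [← mul_assoc (ug n (aD n) (dD n) i r) (ug n (aD n) (dD n) i r)]
  exact serre_of_two_mul h

theorem aD_comm (i j : ℕ) : aD n i j = aD n j i := by
  unfold aD
  split_ifs <;> first | rfl | omega

theorem genD_eq {i : ℕ} (h1 : 1 ≤ i) (h2 : i ≤ n) (r : ℤ) :
    genD n i r = ug n (aD n) (dD n) ⟨i - 1, by omega⟩ r :=
  dif_pos ⟨h1, h2⟩

theorem genD_commute {i j : ℕ} (hi : 1 ≤ i) (hi' : i ≤ n) (hj : 1 ≤ j) (hj' : j ≤ n) (hij : i ≠ j)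
    (ha : aD n i j = 0) (r s : ℤ) : Commute (genD n i r) (genD n j s) := by
  rw [genD_eq hi hi', genD_eq hj hj']
  refine ug_commute _ _ (fun h => hij ?_) ?_ r s
  · have := congrArg Fin.val h
    simp only at this
    omega
  · simpa [Nat.sub_add_cancel hi, Nat.sub_add_cancel hj] using ha

theorem genD_serrePair (ε : Bool) {i j : ℕ} (hi : 1 ≤ i) (hi' : i ≤ n) (hj : 1 ≤ j) (hj' : j ≤ n)
    (hij : i ≠ j) (ha : aD n i j = -1) (r s : ℤ) :
    SerrePair (vpow (sgn ε)) (genD n i r) (genD n j s) := by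
  have hne : (⟨i - 1, by omega⟩ : Fin n) ≠ ⟨j - 1, by omega⟩ := fun h => hij (by
    have := congrArg Fin.val h
    simp only at this
    omega)
  rw [genD_eq hi hi', genD_eq hj hj']
  refine ⟨?_, ?_⟩
  · rw [vpow_sgn_add_inv_eq]
    exact ug_serre_two _ _ hne (by simpa [Nat.sub_add_cancel hi, Nat.sub_add_cancel hj] using ha) r s
  · rw [vpow_sgn_add_inv_eq]
    rw [aD_comm] at ha
    exact ug_serre_two _ _ hne.symm
      (by simpa [Nat.sub_add_cancel hi, Nat.sub_add_cancel hj] using ha) s r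

theorem isTypeD_genD (hn : 4 ≤ n) (ε : Bool) (t : ℕ → ℤ) :
    IsTypeD (vpow (sgn ε)) n fun i => genD n i (t i) where
  path i h1 h2 := genD_serrePair ε h1 (by omega) (by omega) (by omega) (by omega)
    (by unfold aD; split_ifs <;> first | rfl | omega) _ _
  branch := genD_serrePair ε (by omega) (by omega) (by omega) le_rfl (by omega)
    (by unfold aD; split_ifs <;> first | rfl | omega) _ _
  comm i j h1 h2 h3 h4 := genD_commute h1 (by omega) (by omega) h3 (by omega)
    (by unfold aD; split_ifs <;> first | rfl | omega) _ _
  last := genD_commute (by omega) (by omega) (by omega) le_rfl (by omega)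
    (by unfold aD; split_ifs <;> first | rfl | omega) _ _

theorem smul_mem_LusFormD (ε : Bool) (c : ℤ) (w : UD n) (hw : w ∈ LusFormD n) :
    vpow (sgn ε) ^ c • w ∈ LusFormD n := by
  have hgen : ∀ y ∈ ({algebraMap KK (UD n) vv, algebraMap KK (UD n) vv⁻¹} : Set (UD n)),
      y ∈ LusFormD n := fun y hy => Subring.subset_closure (Or.inl hy)
  have hpow : ∀ m : ℤ, algebraMap KK (UD n) (vv ^ m) ∈ LusFormD n := by
    intro m
    obtain ⟨k, rfl | rfl⟩ := m.eq_nat_or_neg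
    · rw [zpow_natCast, map_pow]
      exact Subring.pow_mem _ (hgen _ (by simp)) k
    · rw [zpow_neg, zpow_natCast, ← inv_pow, map_pow]
      exact Subring.pow_mem _ (hgen _ (by simp)) k
  rw [vpow, ← zpow_mul, Algebra.smul_def]
  exact Subring.mul_mem _ (hpow _) hw

theorem divPow_genD_mem (ε : Bool) {i : ℕ} (h1 : 1 ≤ i) (h2 : i ≤ n) (r : ℤ) (k : ℕ) :
    divPow (vpow (sgn ε)) (genD n i r) k ∈ LusFormD n := by
  rw [divPow_natCast, qFactZ_vpow_sgn, genD_eq h1 h2]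
  exact Subring.subset_closure (Or.inr ⟨_, _, _, rfl⟩)

theorem chainE_eq_qChain (u : KK) (t : ℕ → ℤ) (i : ℕ) (l : List ℕ) :
    chainE (genD n) (i :: l) ((i :: l).map t) (List.replicate ((i :: l).length - 1) u) =
      qChain u (fun j => genD n j (t j)) (genD n i (t i)) l := by
  have : ∀ x : UD n, ((l.zip (l.map t)).zip (List.replicate l.length u)).foldl
      (fun acc p => acc * genD n p.1.1 p.1.2 - p.2 • (genD n p.1.1 p.1.2 * acc)) x =
        qChain u (fun j => genD n j (t j)) x l := by
    induction l with
    | nil => intro x; rfl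
    | cons j l ih => intro x; exact ih _
  exact this _

theorem wordD_eq (hn : 4 ≤ n) (β : PosRootD n) :
    (∃ i m, 1 ≤ i ∧ i + m + 1 ≤ n ∧ wordD β = i :: List.range' (i + 1) m) ∨ wordD β = [n] ∨
    ∃ i d, 1 ≤ i ∧ i + 2 ≤ n ∧ i + d + 1 ≤ n ∧ wordD β =
      i :: (List.range' (i + 1) (n - 2 - i) ++ [n] ++ (List.range' (n - d) (n - (n - d))).reverse) := by
  obtain ⟨h1, h2, h3⟩ := β.2
  change 1 ≤ riD β at h1
  change n - 1 ≤ riD β → rtD β = 0 at h2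
  change rtD β = 0 ∨ rtD β + 2 * riD β + 1 ≤ 2 * n at h3
  have h0 : riD β ≤ n := Nat.lt_succ_iff.mp (ofLex β.1).1.2
  have h4 : riD β + 2 ≤ n ∨ rtD β = 0 := by
    rcases Nat.lt_or_ge (riD β) (n - 1) with h | h
    · left; omega
    · exact Or.inr (h2 h)
  unfold wordD
  simp only
  generalize riD β = i at h0 h1 h2 h3 h4 ⊢
  generalize rtD β = t at h2 h3 h4 ⊢
  have hr : i + 2 ≤ n → List.range' i (n - 1 - i) = i :: List.range' (i + 1) (n - 2 - i) := by
    intro h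
    rw [show n - 1 - i = n - 2 - i + 1 by omega, List.range'_succ]
  split_ifs with ha hb hc
  · rcases ha with ha | rfl
    · exact Or.inl ⟨i, t, h1, by omega, List.range'_succ⟩
    · rw [h2 (by omega)]
      exact Or.inr (Or.inl rfl)
  · refine Or.inr (Or.inr ⟨i, 0, h1, by omega, by omega, ?_⟩)
    rw [hr (by omega)]
    simp
  · refine Or.inr (Or.inr ⟨i, 1, h1, by omega, by omega, ?_⟩)
    rw [hr (by omega), show n - (n - 1) = 1 by omega]
    simp
  · refine Or.inr (Or.inr ⟨i, i + t - n, h1, by omega, by omega, ?_⟩)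
    rw [hr (by omega), show n - (i + t - n) = 2 * n - i - t by omega]
    simp

end Loop

/-- **Integrality of normalized divided powers (type `D_n`)**: for every `β ∈ Δ⁺`, `s ∈ ℤ`,
`k ∈ ℕ`, every sign `ε`, and every choice of decomposition `t` of `s` used in defining
`Ẽ^ε_{β,s}`, the normalized divided power `Ẽ^{ε,(k)}_{β,s}` belongs to the Lusztig integral
form `𝐔_v^>(Lo_{2n})`. -/
theorem lusztig_membership_typeD (n : ℕ) (hn : 4 ≤ n) (ε : Bool) (β : PosRootD n) (s : ℤ)
    (t : ℕ → ℤ) (ht : sOfD β t = s) (k : ℕ) :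
    tildeEPowD ε β t k ∈ LusFormD n := by
  have hT := isTypeD_genD hn ε t
  have hu0 := vpow_sgn_ne_zero ε
  have hu := vpow_sgn_zpow_ne ε
  have h2 : vpow (sgn ε) + (vpow (sgn ε))⁻¹ ≠ 0 := by
    rw [vpow_sgn_add_inv_eq]
    exact vv_add_inv_ne_zero
  have hS := smul_mem_LusFormD (n := n) ε
  have he : ∀ i, 1 ≤ i → i ≤ n → ∀ k : ℕ, divPow (vpow (sgn ε)) (genD n i (t i)) k ∈ LusFormD n :=
    fun i h1 h2 k => divPow_genD_mem ε h1 h2 (t i) k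
  rw [tildeEPowD, ← qFactZ_vpow_sgn ε, ← divPow_natCast, tildeED]
  rcases wordD_eq hn β with ⟨i, m, hi, him, hw⟩ | hw | ⟨i, d, hi, hin, hd, hw⟩ <;>
    rw [hw, chainE_eq_qChain]
  · exact hT.divPow_path_mem hu0 h2 hu hS he hi him k
  · exact he n (by omega) le_rfl k
  · rw [qChain_append, qChain_concat]
    exact hT.divPow_reverse_mem hu0 h2 hu hS he hi hin hd k
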